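/- In Version C, the position consisting of k piles of size 1 together with one additional pile of size n is a P-position if and only if either (k ≥ 2n and k + n ≡ 0 (mod 3)) or (k < 2n and k + 2n ≡ 0 (mod 4)). -/

import Mathlib

/-- Remove one token from a pile of size `p` in `G`: delete one copy of `p` and,
if `p ≠ 1`, add back a pile of size `p - 1`. -/
def takeOne (G : Multiset ℕ) (p : ℕ) : Multiset ℕ :=
  G.erase p + (if p = 1 then (0 : Multiset ℕ) else {p - 1})

/-- Legal moves of Version C: remove one token from one chosen pile, or choose two
piles (counted with multiplicity) and remove one token from each of them
(piles reaching size 0 are deleted). -/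
inductive MoveC : Multiset ℕ → Multiset ℕ → Prop
  | one {G : Multiset ℕ} {p : ℕ} (hp : p ∈ G) (h1 : 1 ≤ p) : MoveC G (takeOne G p)
  | two {G : Multiset ℕ} {p q : ℕ} (hp : p ∈ G) (hq : q ∈ G.erase p)
      (h1 : 1 ≤ p) (h2 : 1 ≤ q) : MoveC G (takeOne (takeOne G p) q)

mutual
  /-- P-positions of Version C under normal play: every move leads to an N-position
  (in particular the empty position is a P-position).  Since every move strictly
  decreases the total number of tokens, this inductive definition agrees with the
  usual recursive definition of outcome classes. -/
  inductive PPosC : Multiset ℕ → Prop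
    | mk : ∀ {G : Multiset ℕ}, (∀ H, MoveC G H → NPosC H) → PPosC G
  /-- N-positions of Version C under normal play: some move leads to a P-position. -/
  inductive NPosC : Multiset ℕ → Prop
    | mk : ∀ {G H : Multiset ℕ}, MoveC G H → PPosC H → NPosC G
end

/-- No position is both a P-position and an N-position. -/
theorem PPosC.not_nPosC {G : Multiset ℕ} (h : PPosC G) : ¬ NPosC G := by
  refine PPosC.rec (motive_1 := fun G _ => ¬ NPosC G) (motive_2 := fun G _ => ¬ PPosC G)
    ?_ ?_ h
  · rintro G _ ih ⟨hm, hP⟩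
    exact ih _ hm hP
  · rintro G H hm _ ih ⟨hN⟩
    exact ih (hN _ hm)

/-- One pile of size `n` (absent if `n = 0`) together with `k` piles of size 1. -/
def onesAndPile (n k : ℕ) : Multiset ℕ :=
  (if n = 0 then 0 else {n}) + Multiset.replicate k 1

theorem onesAndPile_succ_left (n k : ℕ) :
    onesAndPile (n + 1) k = (n + 1) ::ₘ Multiset.replicate k 1 := by
  simp [onesAndPile]

theorem onesAndPile_succ_right (n k : ℕ) :
    onesAndPile n (k + 1) = 1 ::ₘ onesAndPile n k := by
  simp [onesAndPile, Multiset.replicate_succ]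

theorem mem_onesAndPile {n k p : ℕ} (h : p ∈ onesAndPile n k) :
    (∃ m, n = m + 1 ∧ p = m + 1) ∨ (∃ j, k = j + 1 ∧ p = 1) := by
  rcases n with _ | n <;> rcases k with _ | k <;>
    simp [onesAndPile, Multiset.mem_replicate] at h ⊢ <;> tauto

theorem takeOne_onesAndPile_left (n k : ℕ) :
    takeOne (onesAndPile (n + 1) k) (n + 1) = onesAndPile n k := by
  rw [takeOne, onesAndPile_succ_left, Multiset.erase_cons_head, add_comm]
  simp [onesAndPile]

theorem takeOne_onesAndPile_right (n k : ℕ) :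
    takeOne (onesAndPile n (k + 1)) 1 = onesAndPile n k := by
  simp [takeOne, onesAndPile_succ_right]

theorem moveC_left (n k : ℕ) : MoveC (onesAndPile (n + 1) k) (onesAndPile n k) := by
  have h := MoveC.one (G := onesAndPile (n + 1) k) (p := n + 1)
    (by simp [onesAndPile_succ_left]) (by omega)
  rwa [takeOne_onesAndPile_left] at h

theorem moveC_right (n k : ℕ) : MoveC (onesAndPile n (k + 1)) (onesAndPile n k) := by
  have h := MoveC.one (G := onesAndPile n (k + 1)) (p := 1)
    (by simp [onesAndPile_succ_right]) le_rfl
  rwa [takeOne_onesAndPile_right] at h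

theorem moveC_right_right (n k : ℕ) : MoveC (onesAndPile n (k + 2)) (onesAndPile n k) := by
  have h := MoveC.two (G := onesAndPile n (k + 2)) (p := 1) (q := 1)
    (by simp [onesAndPile_succ_right]) (by simp [onesAndPile_succ_right]) le_rfl le_rfl
  rwa [takeOne_onesAndPile_right, takeOne_onesAndPile_right] at h

theorem moveC_left_right (n k : ℕ) :
    MoveC (onesAndPile (n + 1) (k + 1)) (onesAndPile n k) := by
  have h := MoveC.two (G := onesAndPile (n + 1) (k + 1)) (p := n + 1) (q := 1)
    (by simp [onesAndPile_succ_left]) (by simp [onesAndPile_succ_left])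
    (by omega) le_rfl
  rwa [takeOne_onesAndPile_left, takeOne_onesAndPile_right] at h

theorem MoveC.exists_eq_onesAndPile {n k : ℕ} {H : Multiset ℕ}
    (h : MoveC (onesAndPile n k) H) :
    ∃ m j, H = onesAndPile m j ∧
      ((n = m + 1 ∧ k = j) ∨ (n = m ∧ k = j + 1) ∨ (n = m ∧ k = j + 2) ∨
        (n = m + 1 ∧ k = j + 1)) := by
  cases h with
  | one hp h1 =>
    rcases mem_onesAndPile hp with ⟨m, rfl, rfl⟩ | ⟨j, rfl, rfl⟩
    · exact ⟨m, k, takeOne_onesAndPile_left _ _, by omega⟩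
    · exact ⟨n, j, takeOne_onesAndPile_right _ _, by omega⟩
  | two hp hq h1 h2 =>
    rcases mem_onesAndPile hp with ⟨m, rfl, rfl⟩ | ⟨j, rfl, rfl⟩
    · rw [onesAndPile_succ_left, Multiset.erase_cons_head, Multiset.mem_replicate] at hq
      obtain ⟨hk, rfl⟩ := hq
      obtain ⟨j, rfl⟩ := Nat.exists_eq_succ_of_ne_zero hk
      exact ⟨m, j, by rw [takeOne_onesAndPile_left, takeOne_onesAndPile_right], by omega⟩
    · rw [takeOne_onesAndPile_right]
      rw [onesAndPile_succ_right, Multiset.erase_cons_head] at hq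
      rcases mem_onesAndPile hq with ⟨m, rfl, rfl⟩ | ⟨i, rfl, rfl⟩
      · exact ⟨m, j, takeOne_onesAndPile_left _ _, by omega⟩
      · exact ⟨n, i, takeOne_onesAndPile_right _ _, by omega⟩

/-- The arithmetic condition characterizing the P-positions `onesAndPile n k`. -/
def IsPPair (n k : ℕ) : Prop :=
  (2 * n ≤ k ∧ (k + n) % 3 = 0) ∨ (k < 2 * n ∧ (k + 2 * n) % 4 = 0)

theorem not_isPPair_of_move {n k m j : ℕ} (h : IsPPair n k)
    (hm : (n = m + 1 ∧ k = j) ∨ (n = m ∧ k = j + 1) ∨ (n = m ∧ k = j + 2) ∨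
      (n = m + 1 ∧ k = j + 1)) : ¬ IsPPair m j := by
  unfold IsPPair at *
  omega

theorem exists_moveC_isPPair {n k : ℕ} (h : ¬ IsPPair n k) :
    ∃ m j, m + j < n + k ∧ MoveC (onesAndPile n k) (onesAndPile m j) ∧ IsPPair m j := by
  by_cases h1 : ∃ m, n = m + 1 ∧ IsPPair m k
  · obtain ⟨m, rfl, hP⟩ := h1
    exact ⟨m, k, by omega, moveC_left _ _, hP⟩
  by_cases h2 : ∃ j, k = j + 1 ∧ IsPPair n j
  · obtain ⟨j, rfl, hP⟩ := h2
    exact ⟨n, j, by omega, moveC_right _ _, hP⟩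
  by_cases h3 : ∃ j, k = j + 2 ∧ IsPPair n j
  · obtain ⟨j, rfl, hP⟩ := h3
    exact ⟨n, j, by omega, moveC_right_right _ _, hP⟩
  by_cases h4 : ∃ m j, n = m + 1 ∧ k = j + 1 ∧ IsPPair m j
  · obtain ⟨m, j, rfl, rfl, hP⟩ := h4
    exact ⟨m, j, by omega, moveC_left_right _ _, hP⟩
  exfalso
  push Not at h1 h2 h3 h4
  have h1 := h1 (n - 1)
  have h2 := h2 (k - 1)
  have h3 := h3 (k - 2)
  have h4 := h4 (n - 1) (k - 1)
  unfold IsPPair at *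
  omega

theorem onesAndPile_outcome (n k : ℕ) :
    (IsPPair n k → PPosC (onesAndPile n k)) ∧
      (¬ IsPPair n k → NPosC (onesAndPile n k)) := by
  induction hs : n + k using Nat.strong_induction_on generalizing n k with
  | _ s ih =>
    subst hs
    refine ⟨fun h => ⟨fun H hH => ?_⟩, fun h => ?_⟩
    · obtain ⟨m, j, rfl, hm⟩ := hH.exists_eq_onesAndPile
      exact (ih (m + j) (by omega) m j rfl).2 (not_isPPair_of_move h hm)
    · obtain ⟨m, j, hlt, hm, hP⟩ := exists_moveC_isPPair h
      exact ⟨hm, (ih (m + j) hlt m j rfl).1 hP⟩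

/-- In Version C, the position consisting of `k` piles of size 1 together with one
pile of size `n` is a P-position iff `k ≥ 2n` and `k + n ≡ 0 (mod 3)`, or `k < 2n`
and `k + 2n ≡ 0 (mod 4)`. -/
theorem versionC_ones_and_one_pile (k n : ℕ) (hn : 1 ≤ n) :
    PPosC (n ::ₘ Multiset.replicate k 1) ↔
      (2 * n ≤ k ∧ (k + n) % 3 = 0) ∨
      (k < 2 * n ∧ (k + 2 * n) % 4 = 0) := by
  obtain ⟨m, rfl⟩ := Nat.exists_eq_add_of_le' hn
  rw [← onesAndPile_succ_left]
  refine ⟨fun h => ?_, (onesAndPile_outcome (m + 1) k).1⟩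
  by_contra hc
  exact h.not_nPosC ((onesAndPile_outcome (m + 1) k).2 hc)
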